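/- Let d : B → D be an abelian crossed module, Q an abelian group and ψ : Q → Coker d a group homomorphism. Then there exists an extension of B by Q of type B → D inducing ψ if and only if there exists a factor pair for (d, ψ). Explicitly, given an extension (E, j, p, ε) inducing ψ and any set-theoretic section e : Q → E of p with e(0) = 0, the functions F(u) := ε(e(u)) and f(u, v) := the unique element of B with j(f(u, v)) = e(u) + e(v) − e(u + v) form a factor pair for (d, ψ), and the associated extension (E₀, j₀, p₀, ε₀) is equivalent to (E, j, p, ε) via (b, u) ↦ j(b) + e(u). -/

import Mathlib

universe u

section

variable {B D Q : Type u} [AddCommGroup B] [AddCommGroup D] [AddCommGroup Q]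

/-- A factor pair for `(d, ψ)`. -/
def IsFactorPair (d : B →+ D) (ψ : Q →+ D ⧸ d.range) (F : Q → D) (f : Q → Q → B) : Prop :=
  F 0 = 0 ∧
  (∀ u, QuotientAddGroup.mk (F u) = ψ u) ∧
  (∀ u v, d (f u v) = F u + F v - F (u + v)) ∧
  (∀ v, f 0 v = 0) ∧ (∀ u, f u 0 = 0) ∧
  (∀ u v t, f v t + f u (v + t) = f u v + f (u + v) t) ∧
  (∀ u v, f u v = f v u)

/-- An extension of `B` by `Q` of type `B → D` inducing `ψ`: a short exact
sequence `0 → B → E → Q → 0` of abelian groups together with `ε : E → D` such that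
`ε ∘ j = d` and `q ∘ ε = ψ ∘ p`. -/
structure ExtensionOfType (d : B →+ D) (ψ : Q →+ D ⧸ d.range) : Type (u + 1) where
  E : Type u
  [instE : AddCommGroup E]
  j : B →+ E
  p : E →+ Q
  ε : E →+ D
  inj : Function.Injective j
  surj : Function.Surjective p
  exact : ∀ x : E, p x = 0 ↔ x ∈ j.range
  comm_j : ∀ b : B, ε (j b) = d b
  comm_p : ∀ x : E, QuotientAddGroup.mk (ε x) = ψ (p x)

/-- The underlying set `B × Q` of the extension associated to a factor pair. -/
@[ext]
structure FactorPairExtension {d : B →+ D} {ψ : Q →+ D ⧸ d.range} {F : Q → D} {f : Q → Q → B}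
    (h : IsFactorPair d ψ F f) : Type u where
  fst : B
  snd : Q

namespace FactorPairExtension

variable {d : B →+ D} {ψ : Q →+ D ⧸ d.range} {F : Q → D} {f : Q → Q → B}
  (h : IsFactorPair d ψ F f)

instance : Add (FactorPairExtension h) := ⟨fun x y => ⟨x.1 + y.1 + f x.2 y.2, x.2 + y.2⟩⟩

instance : Zero (FactorPairExtension h) := ⟨⟨0, 0⟩⟩

instance : Neg (FactorPairExtension h) := ⟨fun x => ⟨-x.1 - f (-x.2) x.2, -x.2⟩⟩

@[simp] lemma add_fst (x y : FactorPairExtension h) : (x + y).1 = x.1 + y.1 + f x.2 y.2 := rfl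

@[simp] lemma add_snd (x y : FactorPairExtension h) : (x + y).2 = x.2 + y.2 := rfl

@[simp] lemma zero_fst : (0 : FactorPairExtension h).1 = 0 := rfl

@[simp] lemma zero_snd : (0 : FactorPairExtension h).2 = 0 := rfl

@[simp] lemma neg_fst (x : FactorPairExtension h) : (-x).1 = -x.1 - f (-x.2) x.2 := rfl

@[simp] lemma neg_snd (x : FactorPairExtension h) : (-x).2 = -x.2 := rfl

instance : AddCommGroup (FactorPairExtension h) where
  add_assoc x y z := by
    obtain ⟨-, -, -, -, -, hassoc, -⟩ := id h
    ext
    · have := hassoc x.2 y.2 z.2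
      simp only [add_fst, add_snd]
      calc _ = x.1 + y.1 + z.1 + (f x.2 y.2 + f (x.2 + y.2) z.2) := by abel
        _ = _ := by rw [← this]; abel
    · simp [add_assoc]
  zero_add x := by
    obtain ⟨-, -, -, hzero, -⟩ := id h
    ext <;> simp [hzero]
  add_zero x := by
    obtain ⟨-, -, -, -, hzero, -⟩ := id h
    ext <;> simp [hzero]
  neg_add_cancel x := by
    ext
    · simp only [add_fst, neg_fst, neg_snd, zero_fst]
      abel
    · simp
  add_comm x y := by
    obtain ⟨-, -, -, -, -, -, hcomm⟩ := id h
    ext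
    · simp [hcomm x.2 y.2, add_comm x.1]
    · simp [add_comm]
  nsmul := nsmulRec
  zsmul := zsmulRec

/-- The extension associated to a factor pair. -/
def extension : ExtensionOfType d ψ where
  E := FactorPairExtension h
  j :=
    { toFun := fun b => ⟨b, 0⟩
      map_zero' := rfl
      map_add' := fun b c => by
        obtain ⟨-, -, -, hzero, -⟩ := id h
        ext <;> simp [hzero] }
  p :=
    { toFun := fun x => x.2
      map_zero' := rfl
      map_add' := fun _ _ => rfl }
  ε :=
    { toFun := fun x => d x.1 + F x.2
      map_zero' := by simp [h.1]
      map_add' := fun x y => by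
        obtain ⟨-, -, hd, -⟩ := id h
        simp only [add_fst, add_snd, map_add, hd]
        abel }
  inj b c hbc := congrArg fst hbc
  surj u := ⟨⟨0, u⟩, rfl⟩
  exact x := by
    constructor
    · intro hx
      exact ⟨x.1, FactorPairExtension.ext rfl hx.symm⟩
    · rintro ⟨b, rfl⟩
      rfl
  comm_j b := by simp [h.1]
  comm_p x := by
    obtain ⟨-, hψ, -⟩ := id h
    have hx : (QuotientAddGroup.mk (d x.1) : D ⧸ d.range) = 0 :=
      (QuotientAddGroup.eq_zero_iff _).2 ⟨x.1, rfl⟩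
    change (QuotientAddGroup.mk (d x.1 + F x.2) : D ⧸ d.range) = ψ x.2
    rw [QuotientAddGroup.mk_add, hx, zero_add, hψ]

end FactorPairExtension

lemma existsUnique_map_eq_of_section {B E Q : Type*} [AddCommGroup B] [AddCommGroup E]
    [AddCommGroup Q] {j : B →+ E} {p : E →+ Q} (hj : Function.Injective j)
    (hex : ∀ z : E, p z = 0 ↔ z ∈ j.range) {e : Q → E} (he : ∀ u, p (e u) = u) (u v : Q) :
    ∃! b : B, j b = e u + e v - e (u + v) := by
  obtain ⟨b, hb⟩ := (hex (e u + e v - e (u + v))).1 (by simp [he])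
  exact ⟨b, hb, fun c hc => hj (hc.trans hb.symm)⟩

lemma isFactorPair_of_section {d : B →+ D} {ψ : Q →+ D ⧸ d.range} {E : Type*} [AddCommGroup E]
    {j : B →+ E} {p : E →+ Q} {ε : E →+ D} (hj : Function.Injective j)
    (hd : ∀ b : B, ε (j b) = d b) (hψ : ∀ z : E, QuotientAddGroup.mk (ε z) = ψ (p z))
    {e : Q → E} (he : ∀ u, p (e u) = u) (he0 : e 0 = 0) {f : Q → Q → B}
    (hf : ∀ u v, j (f u v) = e u + e v - e (u + v)) :
    IsFactorPair d ψ (fun u => ε (e u)) f := by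
  refine ⟨by simp [he0], fun u => by rw [hψ, he], fun u v => by rw [← hd, hf]; simp,
    fun v => hj (by simp [hf, he0]), fun u => hj (by simp [hf, he0]),
    fun u v t => hj ?_, fun u v => hj ?_⟩
  · simp only [map_add, hf, add_assoc u v t]
    abel
  · rw [hf, hf, add_comm u v, add_comm (e u)]

/-- **Statement 18.** There exists an extension of `B` by `Q` of type `B → D`
inducing `ψ` if and only if there exists a factor pair for `(d, ψ)`.  Explicitly,
given an extension `(E, j, p, ε)` inducing `ψ` and a set-theoretic section
`e : Q → E` of `p` with `e 0 = 0`, the functions `F u := ε (e u)` and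
`f u v :=` the unique element of `B` with `j (f u v) = e u + e v − e (u + v)` form
a factor pair for `(d, ψ)`, and the associated semidirect-product extension
`(E₀ = B × Q, j₀, p₀, ε₀)` (with operation `(b, u) + (c, v) = (b + c + f u v, u + v)`
and `ε₀ (b, u) = d b + F u`) is equivalent to `(E, j, p, ε)` via
`(b, u) ↦ j b + e u`. -/
theorem extension_exists_iff_factor_pair (d : B →+ D) (ψ : Q →+ D ⧸ d.range) :
    -- the existence criterion
    ((∃ (F : Q → D) (f : Q → Q → B), IsFactorPair d ψ F f) ↔
      Nonempty (ExtensionOfType d ψ)) ∧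
    -- the explicit construction
    (∀ (E : Type u) [AddCommGroup E] (j : B →+ E) (p : E →+ Q) (ε : E →+ D),
      Function.Injective j → Function.Surjective p →
      (∀ z : E, p z = 0 ↔ z ∈ j.range) →
      (∀ b : B, ε (j b) = d b) →
      (∀ z : E, QuotientAddGroup.mk (ε z) = ψ (p z)) →
      ∀ e : Q → E, (∀ u, p (e u) = u) → e 0 = 0 →
        -- `f u v` exists and is unique
        (∀ u v : Q, ∃! b : B, j b = e u + e v - e (u + v)) ∧
        (∀ f : Q → Q → B, (∀ u v, j (f u v) = e u + e v - e (u + v)) →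
          -- `(F, f)` is a factor pair for `(d, ψ)`
          IsFactorPair d ψ (fun u => ε (e u)) f ∧
          -- `(b, u) ↦ j b + e u` is an equivalence of extensions from the
          -- associated extension `(E₀, j₀, p₀, ε₀)` to `(E, j, p, ε)`:
          -- it is a group isomorphism ...
          Function.Bijective (fun bu : B × Q => j bu.1 + e bu.2) ∧
          (∀ (b c : B) (u v : Q),
            j (b + c + f u v) + e (u + v) = (j b + e u) + (j c + e v)) ∧
          -- ... commuting with `j₀`, `p₀` and `ε₀`
          (∀ b : B, j b + e 0 = j b) ∧
          (∀ (b : B) (u : Q), p (j b + e u) = u) ∧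
          (∀ (b : B) (u : Q), ε (j b + e u) = d b + ε (e u)))) := by
  refine ⟨⟨fun ⟨F, f, h⟩ => ⟨FactorPairExtension.extension h⟩, ?_⟩, ?_⟩
  · rintro ⟨X⟩
    let := X.instE
    obtain ⟨e, he, he0⟩ : ∃ e : Q → X.E, (∀ u, X.p (e u) = u) ∧ e 0 = 0 := by
      obtain ⟨s, hs⟩ := X.surj.hasRightInverse
      exact ⟨fun u => s u - s 0, fun u => by simp [hs _], sub_self _⟩
    choose f hf using fun u v =>
      (existsUnique_map_eq_of_section X.inj X.exact he u v).exists
    exact ⟨_, f, isFactorPair_of_section X.inj X.comm_j X.comm_p he he0 hf⟩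
  · intro E _ j p ε hj _ hex hd hψ e he he0
    have hp : ∀ (b : B) (u : Q), p (j b + e u) = u := fun b u => by
      rw [map_add, (hex (j b)).2 ⟨b, rfl⟩, he, zero_add]
    refine ⟨existsUnique_map_eq_of_section hj hex he, fun f hf =>
      ⟨isFactorPair_of_section hj hd hψ he he0 hf, ⟨?_, ?_⟩, fun b c u v => ?_,
        fun b => by rw [he0, add_zero], hp, fun b u => by rw [map_add, hd]⟩⟩
    · rintro ⟨b, u⟩ ⟨c, v⟩ (hbc : j b + e u = j c + e v)
      obtain rfl : u = v := by rw [← hp b u, hbc, hp]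
      rw [hj (add_right_cancel hbc)]
    · intro z
      obtain ⟨b, hb⟩ := (hex (z - e (p z))).1 (by simp [he])
      exact ⟨(b, p z), by simp [hb]⟩
    · rw [map_add, map_add, hf]
      abel

end
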